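/- arXiv:2406.16785 — 5 statements merged into one kernel-verified Lean document; each statement's English description precedes it below -/
import Mathlib

section
/- Well-definedness of κ: For every simplicial model 𝒞 = (C,χ,ℓ), the structure κ(𝒞) = (S,∼,L) with S = ℱ(C), X ∼_a Y iff a ∈ χ(X ∩ Y), and L(X) = ℓ(X) ∪ χ(X), is a partial epistemic model; in particular each ∼_a is a partial equivalence relation, each ∼_a is proper, and the valuation constraints hold. -/
namespace ISC

/-- Epistemic language `L⁺`: global atoms, local atoms, negation, conjunction,
and the possibility modality `K̂ₐ`. Local atoms are elements of `P`, with
`π : P → A` assigning to each local atom its owner agent. -/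
inductive Form (A P : Type) : Type where
  | glob : A → Form A P
  | atom : P → Form A P
  | neg  : Form A P → Form A P
  | conj : Form A P → Form A P → Form A P
  | know : A → Form A P → Form A P

/-- Formulas of the language `L⁻`, i.e., without global atoms. -/
def Form.NoGlobal {A P : Type} : Form A P → Prop
  | .glob _ => False
  | .atom _ => True
  | .neg φ => φ.NoGlobal
  | .conj φ ψ => φ.NoGlobal ∧ ψ.NoGlobal
  | .know _ φ => φ.NoGlobal

/-- Subformula relation. -/
inductive Form.Subformula {A P : Type} : Form A P → Form A P → Prop where
  | refl (φ : Form A P) : Form.Subformula φ φ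
  | neg {ψ φ : Form A P} : Form.Subformula ψ φ → Form.Subformula ψ (.neg φ)
  | conj_left {ψ φ χ : Form A P} : Form.Subformula ψ φ → Form.Subformula ψ (.conj φ χ)
  | conj_right {ψ φ χ : Form A P} : Form.Subformula ψ χ → Form.Subformula ψ (.conj φ χ)
  | know {ψ φ : Form A P} {a : A} : Form.Subformula ψ φ → Form.Subformula ψ (.know a φ)

/-- A (data of a) simplicial model: a collection of simplexes (sets of vertices),
a chromatic map and a valuation. -/
structure SimpModel (A P : Type) (π : P → A) (V : Type) : Type where
  C : Set (Set V)
  χ : V → A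
  ℓ : V → Set P

namespace SimpModel

variable {A P : Type} {π : P → A} {V V' : Type}

/-- The axioms of a simplicial model. -/
def IsWellFormed (M : SimpModel A P π V) : Prop :=
  M.C.Nonempty ∧
  (∀ X ∈ M.C, X.Finite ∧ X.Nonempty) ∧
  (∀ X ∈ M.C, ∀ Y : Set V, Y.Nonempty → Y ⊆ X → Y ∈ M.C) ∧
  (∀ v : V, {v} ∈ M.C) ∧
  (∀ X ∈ M.C, ∀ u ∈ X, ∀ w ∈ X, M.χ u = M.χ w → u = w) ∧
  (∀ v : V, ∀ p ∈ M.ℓ v, π p = M.χ v)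

/-- A facet: a ⊆-maximal simplex. -/
def isFacet (M : SimpModel A P π V) (X : Set V) : Prop :=
  X ∈ M.C ∧ ∀ Y ∈ M.C, X ⊆ Y → X = Y

/-- `ℓ(X)`, the local atoms of a simplex. -/
def lab (M : SimpModel A P π V) (X : Set V) : Set P := ⋃ v ∈ X, M.ℓ v

/-- Definability `𝒞,X ⋈ φ`. -/
def defined (M : SimpModel A P π V) : Set V → Form A P → Prop
  | _, .glob _ => True
  | X, .atom p => π p ∈ M.χ '' X
  | X, .neg φ => M.defined X φ
  | X, .conj φ ψ => M.defined X φ ∧ M.defined X ψ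
  | X, .know a φ => ∃ Y : Set V, M.isFacet Y ∧ a ∈ M.χ '' (X ∩ Y) ∧ M.defined Y φ

/-- Satisfaction `𝒞,X ⊨ φ`. -/
def sat (M : SimpModel A P π V) : Set V → Form A P → Prop
  | X, .glob a => a ∈ M.χ '' X
  | X, .atom p => p ∈ M.lab X
  | X, .neg φ => M.defined X φ ∧ ¬ M.sat X φ
  | X, .conj φ ψ => M.sat X φ ∧ M.sat X ψ
  | X, .know a φ => ∃ Y : Set V, M.isFacet Y ∧ a ∈ M.χ '' (X ∩ Y) ∧ M.sat Y φ

/-- Star-finiteness: each facet has only finitely many `a`-adjacent facets. -/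
def StarFinite (M : SimpModel A P π V) : Prop :=
  ∀ (a : A) (X : Set V), M.isFacet X →
    {Y : Set V | M.isFacet Y ∧ a ∈ M.χ '' (X ∩ Y)}.Finite

end SimpModel

/-- Modal equivalence of pointed simplicial models in a language `L`. -/
def ModEquiv {A P : Type} {π : P → A} {V V' : Type} (L : Set (Form A P))
    (M : SimpModel A P π V) (X : Set V)
    (M' : SimpModel A P π V') (X' : Set V') : Prop :=
  ∀ φ ∈ L,
    (M.defined X φ ↔ M'.defined X' φ) ∧
    (M.sat X φ ↔ M'.sat X' φ) ∧
    (M.sat X (.neg φ) ↔ M'.sat X' (.neg φ))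

/-- `B` is a bisimulation between the simplicial models `M` and `M'`. -/
def IsBisim {A P : Type} {π : P → A} {V V' : Type}
    (M : SimpModel A P π V) (M' : SimpModel A P π V')
    (B : Set V → Set V' → Prop) : Prop :=
  (∃ X X', B X X') ∧
  (∀ X X', B X X' → M.isFacet X ∧ M'.isFacet X') ∧
  (∀ X X', B X X' →
    (M.χ '' X = M'.χ '' X' ∧ M.lab X = M'.lab X') ∧
    (∀ (a : A) (Y : Set V), M.isFacet Y → a ∈ M.χ '' (X ∩ Y) →
      ∃ Y' : Set V', M'.isFacet Y' ∧ a ∈ M'.χ '' (X' ∩ Y') ∧ B Y Y') ∧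
    (∀ (a : A) (Y' : Set V'), M'.isFacet Y' → a ∈ M'.χ '' (X' ∩ Y') →
      ∃ Y : Set V, M.isFacet Y ∧ a ∈ M.χ '' (X ∩ Y) ∧ B Y Y'))

/-- Bisimilarity of pointed simplicial models. -/
def Bisimilar {A P : Type} {π : P → A} {V V' : Type}
    (M : SimpModel A P π V) (X : Set V)
    (M' : SimpModel A P π V') (X' : Set V') : Prop :=
  ∃ B, IsBisim M M' B ∧ B X X'

/-- Labeled rooted trees: a node carries a set of agents, each edge to a child
carries an agent. -/
inductive LTree (A : Type) : Type where
  | node : Set A → List (A × LTree A) → LTree A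

namespace LTree

/-- The label of the root. -/
def label {A : Type} : LTree A → Set A
  | .node s _ => s

/-- The list of children of the root, paired with their edge labels. -/
def children {A : Type} : LTree A → List (A × LTree A)
  | .node _ cs => cs

/-- The `a`-grafting: add `a` to the root label. -/
def graft {A : Type} (a : A) : LTree A → LTree A
  | .node s cs => .node (insert a s) cs

/-- The life-tree condition: every `a`-edge satisfies `a ∈ L(σ) ∩ L(τ)`. -/
def IsLife {A : Type} : LTree A → Prop
  | .node s cs => ∀ p ∈ cs, p.1 ∈ s ∧ p.1 ∈ p.2.label ∧ p.2.IsLife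
  decreasing_by
    rename_i h
    have h2 := List.sizeOf_lt_of_mem h
    obtain ⟨x, y⟩ := p
    simp at h2 ⊢
    omega

end LTree

/-- The life tree `ℒ⟨φ⟩` of a formula. -/
def Form.lifeTree {A P : Type} (π : P → A) : Form A P → LTree A
  | .glob _ => .node ∅ []
  | .atom p => .node {π p} []
  | .neg φ => φ.lifeTree π
  | .conj φ ψ =>
      .node ((φ.lifeTree π).label ∪ (ψ.lifeTree π).label)
            ((φ.lifeTree π).children ++ (ψ.lifeTree π).children)
  | .know a φ => .node {a} [(a, LTree.graft a (φ.lifeTree π))]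

/-- `𝒞,X ⋈ 𝔗`: there is an embedding of the tree `𝔗` into `(𝒞,X)`, i.e., a map
from tree nodes to facets sending the root to `X`, node labels into the colors
of the corresponding facets, and every `a`-edge to a pair of `a`-adjacent facets. -/
def SimpModel.Embeds {A P : Type} {π : P → A} {V : Type}
    (M : SimpModel A P π V) : Set V → LTree A → Prop
  | X, .node s cs =>
      s ⊆ M.χ '' X ∧
      ∀ p ∈ cs, ∃ Y : Set V, M.isFacet Y ∧ p.1 ∈ M.χ '' (X ∩ Y) ∧ M.Embeds Y p.2
  decreasing_by
    rename_i h
    have h2 := List.sizeOf_lt_of_mem h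
    obtain ⟨x, y⟩ := p
    simp at h2 ⊢
    omega

/-- A (data of a) partial epistemic model: a relation for every agent and a
valuation assigning to states sets of global (`Sum.inl`) and local (`Sum.inr`) atoms. -/
structure PEModel (A P : Type) (π : P → A) (S : Type) : Type where
  rel : A → S → S → Prop
  L : S → Set (A ⊕ P)

namespace PEModel

variable {A P : Type} {π : P → A} {S S' : Type}

/-- The axioms of a partial epistemic model: each `∼ₐ` is a partial equivalence
relation (symmetric and transitive) and proper, local atoms of live agents are
constant on `∼ₐ`-classes, and the global atom `a` holds exactly where `a` is alive. -/
def IsWellFormed (M : PEModel A P π S) : Prop :=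
  (∀ (a : A) (s t : S), M.rel a s t → M.rel a t s) ∧
  (∀ (a : A) (s t u : S), M.rel a s t → M.rel a t u → M.rel a s u) ∧
  (∀ s t : S, s ≠ t → ∃ b : A, M.rel b s s ∧ ¬ M.rel b s t) ∧
  (∀ (a : A) (p : P), π p = a → ∀ s t : S, M.rel a s t →
      (Sum.inr p ∈ M.L s ↔ Sum.inr p ∈ M.L t)) ∧
  (∀ (a : A) (s : S), Sum.inl a ∈ M.L s ↔ M.rel a s s)

/-- Definability `M,s ⋈ φ` on partial epistemic models. -/
def defined (M : PEModel A P π S) : S → Form A P → Prop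
  | _, .glob _ => True
  | s, .atom p => M.rel (π p) s s
  | s, .neg φ => M.defined s φ
  | s, .conj φ ψ => M.defined s φ ∧ M.defined s ψ
  | s, .know a φ => ∃ t : S, M.rel a t s ∧ M.defined t φ

/-- Satisfaction `M,s ⊨ φ` on partial epistemic models. -/
def sat (M : PEModel A P π S) : S → Form A P → Prop
  | s, .glob a => M.rel a s s
  | s, .atom p => M.rel (π p) s s ∧ Sum.inr p ∈ M.L s
  | s, .neg φ => M.defined s φ ∧ ¬ M.sat s φ
  | s, .conj φ ψ => M.sat s φ ∧ M.sat s ψ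
  | s, .know a φ => ∃ t : S, M.rel a t s ∧ M.sat t φ

/-- Image-finiteness: every `∼ₐ`-equivalence class is finite. -/
def ImageFinite (M : PEModel A P π S) : Prop :=
  ∀ (a : A) (s : S), M.rel a s s → {t : S | M.rel a s t}.Finite

/-- The `∼ₐ`-class `[s]ₐ`. -/
def cls (M : PEModel A P π S) (a : A) (s : S) : Set S := {t | M.rel a s t}

/-- Vertices of `σ(M)`: pairs `([s]ₐ, a)` with `a` alive in `s`. -/
def SVtx (M : PEModel A P π S) : Type :=
  {va : Set S × A // ∃ s : S, M.rel va.2 s s ∧ va.1 = M.cls va.2 s}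

/-- The set of vertices `{([s]ₐ, a) | a ∈ B}`. -/
def sigmaSet (M : PEModel A P π S) (s : S) (B : Set A) : Set M.SVtx :=
  {v : M.SVtx | v.val.2 ∈ B ∧ v.val.1 = M.cls v.val.2 s}

/-- The simplicial model `σ(M)` associated with a partial epistemic model. -/
def sigma (M : PEModel A P π S) : SimpModel A P π M.SVtx where
  C := {X : Set M.SVtx |
    ∃ (s : S) (B : Set A), B.Nonempty ∧ (∀ a ∈ B, M.rel a s s) ∧ X = M.sigmaSet s B}
  χ := fun v => v.val.2
  ℓ := fun v => {p : P | π p = v.val.2 ∧ ∃ t ∈ v.val.1, Sum.inr p ∈ M.L t}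

/-- The facet `σ(s) = {([s]ₐ, a) | a ∈ Aₛ}`. -/
def sigmaF (M : PEModel A P π S) (s : S) : Set M.SVtx :=
  M.sigmaSet s {a : A | M.rel a s s}

end PEModel

/-- The partial epistemic model `κ(𝒞)` associated with a simplicial model:
states are the facets, `X ∼ₐ Y` iff `a ∈ χ(X ∩ Y)`, and `L(X) = ℓ(X) ∪ χ(X)`. -/
def SimpModel.kappa {A P : Type} {π : P → A} {V : Type} (M : SimpModel A P π V) :
    PEModel A P π {X : Set V // M.isFacet X} where
  rel := fun a X Y => a ∈ M.χ '' (X.val ∩ Y.val)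
  L := fun X => (Sum.inl '' (M.χ '' X.val)) ∪ (Sum.inr '' M.lab X.val)

/-- `Z` is a life bisimulation between partial epistemic models. -/
def IsLifeBisim {A P : Type} {π : P → A} {S S' : Type}
    (M : PEModel A P π S) (M' : PEModel A P π S') (Z : S → S' → Prop) : Prop :=
  (∃ s s', Z s s') ∧
  ∀ s s', Z s s' →
    ((∀ a : A, Sum.inl a ∈ M.L s ↔ Sum.inl a ∈ M'.L s') ∧
     (∀ a : A, M.rel a s s → ∀ p : P, π p = a →
        (Sum.inr p ∈ M.L s ↔ Sum.inr p ∈ M'.L s'))) ∧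
    (∀ a : A, M.rel a s s → ∀ t : S, M.rel a t s →
        ∃ t' : S', M'.rel a t' s' ∧ Z t t') ∧
    (∀ a : A, M'.rel a s' s' → ∀ t' : S', M'.rel a t' s' →
        ∃ t : S, M.rel a t s ∧ Z t t')

/-- `Z` is a standard bisimulation between partial epistemic models. -/
def IsStdBisim {A P : Type} {π : P → A} {S S' : Type}
    (M : PEModel A P π S) (M' : PEModel A P π S') (Z : S → S' → Prop) : Prop :=
  (∃ s s', Z s s') ∧
  ∀ s s', Z s s' →
    ((∀ a : A, Sum.inl a ∈ M.L s ↔ Sum.inl a ∈ M'.L s') ∧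
     (∀ p : P, Sum.inr p ∈ M.L s ↔ Sum.inr p ∈ M'.L s')) ∧
    (∀ (a : A) (t : S), M.rel a t s → ∃ t' : S', M'.rel a t' s' ∧ Z t t') ∧
    (∀ (a : A) (t' : S'), M'.rel a t' s' → ∃ t : S, M.rel a t s ∧ Z t t')

/-- Modal equivalence of pointed partial epistemic models (in `L⁺`). -/
def ModEquivPar {A P : Type} {π : P → A} {S S' : Type}
    (M : PEModel A P π S) (s : S) (M' : PEModel A P π S') (s' : S') : Prop :=
  ∀ φ : Form A P,
    (M.defined s φ ↔ M'.defined s' φ) ∧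
    (M.sat s φ ↔ M'.sat s' φ) ∧
    (M.sat s (.neg φ) ↔ M'.sat s' (.neg φ))

namespace SimpModel

variable {A P V : Type} {π : P → A} {M : SimpModel A P π V}

/-- The chromatic map is injective on facets of a simplicial model. -/
theorem isFacet.injOn_χ {X : Set V} (hX : M.isFacet X) (hM : M.IsWellFormed) :
    Set.InjOn M.χ X :=
  fun u hu w hw h => hM.2.2.2.2.1 X hX.1 u hu w hw h

theorem isFacet.exists_mem_notMem {X Y : Set V} (hX : M.isFacet X) (hY : M.isFacet Y)
    (h : X ≠ Y) : ∃ v ∈ X, v ∉ Y :=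
  Set.not_subset.1 fun hXY => h (hX.2 Y hY.1 hXY)

/-- Local atoms of an agent transfer between facets sharing a vertex of that agent. -/
theorem isFacet.mem_lab_of_adj {X Y : Set V} (hX : M.isFacet X) (hM : M.IsWellFormed)
    {p : P} (h : π p ∈ M.χ '' (X ∩ Y)) (hp : p ∈ M.lab X) : p ∈ M.lab Y := by
  obtain ⟨v, ⟨hvX, hvY⟩, hv⟩ := h
  obtain ⟨u, huX, hpu⟩ := Set.mem_iUnion₂.1 hp
  obtain rfl : v = u := hX.injOn_χ hM hvX huX (hv.trans (hM.2.2.2.2.2 u p hpu))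
  exact Set.mem_iUnion₂.2 ⟨v, hvY, hpu⟩

theorem inl_mem_kappa_L {X : {X : Set V // M.isFacet X}} {a : A} :
    Sum.inl a ∈ M.kappa.L X ↔ a ∈ M.χ '' X.val := by
  simp [kappa]

theorem inr_mem_kappa_L {X : {X : Set V // M.isFacet X}} {p : P} :
    Sum.inr p ∈ M.kappa.L X ↔ p ∈ M.lab X.val := by
  simp [kappa]

theorem kappa_rel_symm {a : A} {X Y : {X : Set V // M.isFacet X}}
    (h : M.kappa.rel a X Y) : M.kappa.rel a Y X := by
  simpa only [kappa, Set.inter_comm] using h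

theorem kappa_rel_self {a : A} {X : {X : Set V // M.isFacet X}} :
    M.kappa.rel a X X ↔ a ∈ M.χ '' X.val := by
  simp only [kappa, Set.inter_self]

end SimpModel

/-- **Well-definedness of `κ`.** For every simplicial model `𝒞`, the structure
`κ(𝒞)` (with states the facets, `X ∼ₐ Y` iff `a ∈ χ(X ∩ Y)`, and
`L(X) = ℓ(X) ∪ χ(X)`) is a partial epistemic model: each `∼ₐ` is a partial
equivalence relation, each `∼ₐ` is proper, and the valuation constraints hold. -/
theorem kappa_well_defined
    {A P V : Type} [Fintype A] [Countable P] {π : P → A}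
    (M : SimpModel A P π V) (hM : M.IsWellFormed) :
    (M.kappa).IsWellFormed := by
  refine ⟨fun a X Y => SimpModel.kappa_rel_symm, ?_, ?_, ?_, ?_⟩
  · rintro a X Y Z ⟨v, ⟨hvX, hvY⟩, hv⟩ ⟨w, ⟨hwY, hwZ⟩, hw⟩
    obtain rfl : v = w := Y.2.injOn_χ hM hvY hwY (hv.trans hw.symm)
    exact ⟨v, ⟨hvX, hwZ⟩, hv⟩
  · intro X Y hne
    obtain ⟨v, hvX, hvY⟩ := X.2.exists_mem_notMem Y.2 (Subtype.coe_injective.ne hne)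
    refine ⟨M.χ v, SimpModel.kappa_rel_self.2 ⟨v, hvX, rfl⟩, ?_⟩
    rintro ⟨w, ⟨hwX, hwY⟩, hw⟩
    exact hvY (X.2.injOn_χ hM hwX hvX hw ▸ hwY)
  · rintro _ p rfl X Y h
    rw [SimpModel.inr_mem_kappa_L, SimpModel.inr_mem_kappa_L]
    exact ⟨X.2.mem_lab_of_adj hM h,
      Y.2.mem_lab_of_adj hM (SimpModel.kappa_rel_symm h)⟩
  · intro a X
    rw [SimpModel.inl_mem_kappa_L, SimpModel.kappa_rel_self]

end ISC
end

section
/- Proposition 5.7(i): For every formula φ ∈ L⁺ and every pointed partial epistemic model (M,s): M,s ⋈ φ if and only if σ(M),σ(s) ⋈ φ, and M,s ⊨ φ if and only if σ(M),σ(s) ⊨ φ. -/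
namespace ISC

namespace PEModel

variable {A P S : Type} {π : P → A} {M : PEModel A P π S}

theorem cls_eq_cls_iff (hM : M.IsWellFormed) {a : A} {s t : S} (hs : M.rel a s s) :
    M.cls a s = M.cls a t ↔ M.rel a s t := by
  obtain ⟨hsymm, htrans, -⟩ := hM
  constructor
  · intro h
    have hst : s ∈ M.cls a t := h ▸ (show s ∈ M.cls a s from hs)
    exact hsymm a t s hst
  · intro h
    ext u
    exact ⟨htrans a t s u (hsymm a s t h), htrans a s t u h⟩

theorem sigmaSet_subset_sigmaF {s : S} {B : Set A} (hB : ∀ a ∈ B, M.rel a s s) :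
    M.sigmaSet s B ⊆ M.sigmaF s :=
  fun v hv => ⟨hB v.val.2 hv.1, hv.2⟩

theorem mem_chi_image_sigmaF_iff {s : S} {a : A} :
    a ∈ M.sigma.χ '' M.sigmaF s ↔ M.rel a s s := by
  constructor
  · rintro ⟨v, hv, rfl⟩
    exact hv.1
  · intro h
    exact ⟨⟨(M.cls a s, a), s, h, rfl⟩, ⟨h, rfl⟩, rfl⟩

theorem mem_chi_image_sigmaF_inter_iff (hM : M.IsWellFormed) {s t : S} {a : A} :
    a ∈ M.sigma.χ '' (M.sigmaF s ∩ M.sigmaF t) ↔ M.rel a t s := by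
  constructor
  · rintro ⟨v, ⟨hs, ht⟩, rfl⟩
    exact (cls_eq_cls_iff hM ht.1).1 (ht.2.symm.trans hs.2)
  · intro h
    have hs : M.rel a s s := hM.2.1 a s t s (hM.1 a t s h) h
    have ht : M.rel a t t := hM.2.1 a t s t h (hM.1 a t s h)
    exact ⟨⟨(M.cls a s, a), s, hs, rfl⟩,
      ⟨⟨hs, rfl⟩, ⟨ht, ((cls_eq_cls_iff hM ht).2 h).symm⟩⟩, rfl⟩

theorem mem_lab_sigmaF_iff (hM : M.IsWellFormed) {s : S} {p : P} :
    p ∈ M.sigma.lab (M.sigmaF s) ↔ M.rel (π p) s s ∧ Sum.inr p ∈ M.L s := by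
  simp only [SimpModel.lab, Set.mem_iUnion]
  constructor
  · rintro ⟨v, ⟨hs, hv⟩, hp, t, ht, hpt⟩
    rw [hv, ← hp] at ht
    change M.rel v.val.2 s s at hs
    rw [← hp] at hs
    exact ⟨hs, (hM.2.2.2.1 (π p) p rfl s t ht).2 hpt⟩
  · rintro ⟨hs, hp⟩
    exact ⟨⟨(M.cls (π p) s, π p), s, hs, rfl⟩, ⟨hs, rfl⟩, rfl, s, hs, hp⟩

theorem isFacet_sigmaF (hM : M.IsWellFormed) {s : S} {a : A} (ha : M.rel a s s) :
    M.sigma.isFacet (M.sigmaF s) := by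
  refine ⟨⟨s, {a | M.rel a s s}, ⟨a, ha⟩, fun _ h => h, rfl⟩, ?_⟩
  rintro _ ⟨t, B, -, hB, rfl⟩ hsub
  have hst : s = t := by
    by_contra hne
    obtain ⟨b, hb, hbt⟩ := hM.2.2.1 s t hne
    have hv := @hsub ⟨(M.cls b s, b), s, hb, rfl⟩ ⟨hb, rfl⟩
    exact hbt ((cls_eq_cls_iff hM hb).1 hv.2)
  subst hst
  exact hsub.antisymm (sigmaSet_subset_sigmaF hB)

theorem exists_eq_sigmaF_of_isFacet {Y : Set M.SVtx} (hY : M.sigma.isFacet Y) :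
    ∃ t : S, Y = M.sigmaF t := by
  obtain ⟨⟨t, B, ⟨b, hb⟩, hB, rfl⟩, hmax⟩ := hY
  exact ⟨t, hmax _ ⟨t, {a | M.rel a t t}, ⟨b, hB b hb⟩, fun _ h => h, rfl⟩
    (sigmaSet_subset_sigmaF hB)⟩

/-- The `a`-adjacent facets of `σ(s)` are exactly the `σ(t)` with `t ∼ₐ s`. -/
theorem exists_adjacent_facet_iff (hM : M.IsWellFormed) {s : S} {a : A}
    {Q : Set M.SVtx → Prop} :
    (∃ Y, M.sigma.isFacet Y ∧ a ∈ M.sigma.χ '' (M.sigmaF s ∩ Y) ∧ Q Y) ↔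
      ∃ t, M.rel a t s ∧ Q (M.sigmaF t) := by
  constructor
  · rintro ⟨Y, hY, ha, hQ⟩
    obtain ⟨t, rfl⟩ := exists_eq_sigmaF_of_isFacet hY
    exact ⟨t, (mem_chi_image_sigmaF_inter_iff hM).1 ha, hQ⟩
  · rintro ⟨t, ht, hQ⟩
    exact ⟨M.sigmaF t, isFacet_sigmaF hM (hM.2.1 a t s t ht (hM.1 a t s ht)),
      (mem_chi_image_sigmaF_inter_iff hM).2 ht, hQ⟩

end PEModel

/-- **Proposition 5.7(i).** For every `φ ∈ L⁺` and pointed partial epistemic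
model `(M,s)`: `M,s ⋈ φ` iff `σ(M),σ(s) ⋈ φ`, and `M,s ⊨ φ` iff `σ(M),σ(s) ⊨ φ`. -/
theorem sigma_preserves_semantics
    {A P S : Type} [Fintype A] [Countable P] {π : P → A}
    (M : PEModel A P π S) (hM : M.IsWellFormed) (φ : Form A P) (s : S) :
    (M.defined s φ ↔ (M.sigma).defined (M.sigmaF s) φ) ∧
    (M.sat s φ ↔ (M.sigma).sat (M.sigmaF s) φ) := by
  induction φ generalizing s with
  | glob a => exact ⟨Iff.rfl, PEModel.mem_chi_image_sigmaF_iff.symm⟩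
  | atom p => exact ⟨PEModel.mem_chi_image_sigmaF_iff.symm, (PEModel.mem_lab_sigmaF_iff hM).symm⟩
  | neg φ ih => exact ⟨(ih s).1, and_congr (ih s).1 (not_congr (ih s).2)⟩
  | conj φ ψ ihφ ihψ =>
    exact ⟨and_congr (ihφ s).1 (ihψ s).1, and_congr (ihφ s).2 (ihψ s).2⟩
  | know a φ ih =>
    simp only [PEModel.defined, PEModel.sat, SimpModel.defined, SimpModel.sat,
      PEModel.exists_adjacent_facet_iff hM, ih, and_self]

end ISC
end

section
/- Proposition 5.7(ii): For every formula φ ∈ L⁺ and every pointed simplicial model (𝒞,X): 𝒞,X ⋈ φ if and only if κ(𝒞),X ⋈ φ, and 𝒞,X ⊨ φ if and only if κ(𝒞),X ⊨ φ. -/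
namespace ISC

theorem SimpModel.IsWellFormed.owner_mem_of_mem_lab {A P V : Type} {π : P → A}
    {M : SimpModel A P π V} (hM : M.IsWellFormed) {X : Set V} {p : P} (hp : p ∈ M.lab X) :
    π p ∈ M.χ '' X := by
  obtain ⟨v, hv, hpv⟩ := Set.mem_iUnion₂.1 hp
  exact ⟨v, hv, (hM.2.2.2.2.2 v p hpv).symm⟩

theorem SimpModel.kappa_rel_self_s14 {A P V : Type} {π : P → A} (M : SimpModel A P π V)
    (a : A) (X : {X : Set V // M.isFacet X}) : M.kappa.rel a X X ↔ a ∈ M.χ '' X.val := by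
  simp only [SimpModel.kappa, Set.inter_self]

theorem SimpModel.inr_mem_kappa_L_s14 {A P V : Type} {π : P → A} (M : SimpModel A P π V)
    (p : P) (X : {X : Set V // M.isFacet X}) : Sum.inr p ∈ M.kappa.L X ↔ p ∈ M.lab X.val := by
  simp [SimpModel.kappa]

theorem SimpModel.exists_kappa_rel {A P V : Type} {π : P → A} (M : SimpModel A P π V)
    (a : A) (X : {X : Set V // M.isFacet X}) (Q : {X : Set V // M.isFacet X} → Prop)
    (R : Set V → Prop) (h : ∀ Y (hY : M.isFacet Y), R Y ↔ Q ⟨Y, hY⟩) :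
    (∃ Y, M.isFacet Y ∧ a ∈ M.χ '' (X.val ∩ Y) ∧ R Y) ↔ ∃ Y, M.kappa.rel a Y X ∧ Q Y := by
  constructor
  · rintro ⟨Y, hY, ha, hR⟩
    exact ⟨⟨Y, hY⟩, by rwa [Set.inter_comm] at ha, (h Y hY).1 hR⟩
  · rintro ⟨⟨Y, hY⟩, ha, hQ⟩
    exact ⟨Y, hY, by rwa [Set.inter_comm], (h Y hY).2 hQ⟩

/-- **Proposition 5.7(ii).** For every `φ ∈ L⁺` and pointed simplicial model
`(𝒞,X)`: `𝒞,X ⋈ φ` iff `κ(𝒞),X ⋈ φ`, and `𝒞,X ⊨ φ` iff `κ(𝒞),X ⊨ φ`. -/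
theorem kappa_preserves_semantics
    {A P V : Type} [Fintype A] [Countable P] {π : P → A}
    (M : SimpModel A P π V) (hM : M.IsWellFormed)
    (φ : Form A P) (X : Set V) (hX : M.isFacet X) :
    (M.defined X φ ↔ (M.kappa).defined ⟨X, hX⟩ φ) ∧
    (M.sat X φ ↔ (M.kappa).sat ⟨X, hX⟩ φ) := by
  induction φ generalizing X with
  | glob a => exact ⟨Iff.rfl, (M.kappa_rel_self_s14 a ⟨X, hX⟩).symm⟩
  | atom p =>
    refine ⟨(M.kappa_rel_self_s14 (π p) ⟨X, hX⟩).symm, ?_⟩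
    simp only [SimpModel.sat, PEModel.sat, M.kappa_rel_self_s14, M.inr_mem_kappa_L_s14]
    exact (and_iff_right_of_imp hM.owner_mem_of_mem_lab).symm
  | neg φ ih => exact ⟨(ih X hX).1, and_congr (ih X hX).1 (not_congr (ih X hX).2)⟩
  | conj φ ψ ihφ ihψ =>
    exact ⟨and_congr (ihφ X hX).1 (ihψ X hX).1, and_congr (ihφ X hX).2 (ihψ X hX).2⟩
  | know a φ ih =>
    exact ⟨M.exists_kappa_rel a ⟨X, hX⟩ _ _ fun Y hY => (ih Y hY).1,
      M.exists_kappa_rel a ⟨X, hX⟩ _ _ fun Y hY => (ih Y hY).2⟩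

end ISC
end

section
/- Proposition 5.10(2): For any simplicial models 𝒞 and 𝒞', if 𝒞 and 𝒞' are bisimilar, then the partial epistemic models κ(𝒞) and κ(𝒞') are life bisimilar; moreover, if (𝒞,X) is bisimilar to (𝒞',X'), then (κ(𝒞),X) is life bisimilar to (κ(𝒞'),X'). -/
namespace ISC

/-- A bisimulation between simplicial models is a life bisimulation between their
images under `κ`. -/
theorem IsBisim.isLifeBisim_kappa {A P V V' : Type} {π : P → A}
    {M : SimpModel A P π V} {M' : SimpModel A P π V'} {B : Set V → Set V' → Prop}
    (hB : IsBisim M M' B) :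
    IsLifeBisim M.kappa M'.kappa (fun X X' => B X.val X'.val) := by
  obtain ⟨⟨X₀, X₀', h₀⟩, hfacet, hstep⟩ := hB
  refine ⟨⟨⟨X₀, (hfacet _ _ h₀).1⟩, ⟨X₀', (hfacet _ _ h₀).2⟩, h₀⟩, ?_⟩
  rintro ⟨X, hX⟩ ⟨X', hX'⟩ h
  obtain ⟨⟨hχ, hlab⟩, forth, back⟩ := hstep X X' h
  have hL : M.kappa.L ⟨X, hX⟩ = M'.kappa.L ⟨X', hX'⟩ := by
    simp only [SimpModel.kappa, hχ, hlab]
  refine ⟨⟨fun a => by rw [hL], fun a _ p _ => by rw [hL]⟩, ?_, ?_⟩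
  · rintro a - ⟨Y, hY⟩ hYX
    obtain ⟨Y', hY', ha, hYY'⟩ := forth a Y hY (Set.inter_comm Y X ▸ hYX)
    exact ⟨⟨Y', hY'⟩, ha.imp fun _ => And.imp_left And.symm, hYY'⟩
  · rintro a - ⟨Y', hY'⟩ hYX
    obtain ⟨Y, hY, ha, hYY'⟩ := back a Y' hY' (Set.inter_comm Y' X' ▸ hYX)
    exact ⟨⟨Y, hY⟩, ha.imp fun _ => And.imp_left And.symm, hYY'⟩

/-- **Proposition 5.10(2).** If simplicial models `𝒞` and `𝒞'` are bisimilar,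
then `κ(𝒞)` and `κ(𝒞')` are life bisimilar; moreover, if `(𝒞,X)` is bisimilar
to `(𝒞',X')`, then `(κ(𝒞),X)` is life bisimilar to `(κ(𝒞'),X')`. -/
theorem kappa_preserves_bisimilarity
    {A P V V' : Type} [Fintype A] [Countable P] {π : P → A}
    (M : SimpModel A P π V) (M' : SimpModel A P π V')
    (hM : M.IsWellFormed) (hM' : M'.IsWellFormed) :
    ((∃ B, IsBisim M M' B) → ∃ Z, IsLifeBisim M.kappa M'.kappa Z) ∧
    (∀ (X : Set V) (X' : Set V') (hX : M.isFacet X) (hX' : M'.isFacet X'),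
      Bisimilar M X M' X' →
      ∃ Z, IsLifeBisim M.kappa M'.kappa Z ∧ Z ⟨X, hX⟩ ⟨X', hX'⟩) := by
  exact ⟨fun ⟨_, hB⟩ => ⟨_, hB.isLifeBisim_kappa⟩,
    fun _ _ _ _ ⟨_, hB, hXX'⟩ => ⟨_, hB.isLifeBisim_kappa, hXX'⟩⟩

end ISC
end

section
/- Theorem 5.12 (Hennessy–Milner property for partial epistemic models): For any image-finite pointed partial epistemic models (M,s) and (M',s'): (M,s) is life bisimilar to (M',s') if and only if (M,s) ≡^par (M',s'). -/
namespace ISC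

namespace PEModel

variable {A P : Type} {π : P → A} {S S' : Type}

theorem IsWellFormed.rel_symm {M : PEModel A P π S} (hM : M.IsWellFormed) {a : A} {s t : S}
    (h : M.rel a s t) : M.rel a t s :=
  hM.1 a s t h

theorem IsWellFormed.rel_refl_right {M : PEModel A P π S} (hM : M.IsWellFormed) {a : A} {s t : S}
    (h : M.rel a t s) : M.rel a s s :=
  hM.2.1 a s t s (hM.rel_symm h) h

theorem defined_of_sat (M : PEModel A P π S) {φ : Form A P} {s : S} (h : M.sat s φ) :
    M.defined s φ := by
  induction φ generalizing s with
  | glob a => trivial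
  | atom p => exact h.1
  | neg φ _ => exact h.1
  | conj φ ψ ih₁ ih₂ => exact ⟨ih₁ h.1, ih₂ h.2⟩
  | know a φ ih =>
    obtain ⟨t, ht, h⟩ := h
    exact ⟨t, ht, ih h⟩

end PEModel

namespace Form

variable {A P : Type}

/-- A formula true at every state. -/
def top (a : A) : Form A P := .neg (.conj (.glob a) (.neg (.glob a)))

/-- A formula that is satisfied exactly where `φ` is defined. -/
def definedness (π : P → A) (a₀ : A) : Form A P → Form A P
  | .glob _ => top a₀
  | .atom p => .glob (π p)
  | .neg φ => φ.definedness π a₀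
  | .conj φ ψ => .conj (φ.definedness π a₀) (ψ.definedness π a₀)
  | .know a φ => .know a (φ.definedness π a₀)

/-- `β` strengthens `α` and is defined wherever `α` is satisfied. -/
def Refines (π : P → A) (α β : Form A P) : Prop :=
  ∀ (S : Type) (M : PEModel A P π S), M.IsWellFormed → ∀ s : S,
    (M.sat s β → M.sat s α) ∧ (M.sat s α → M.defined s β)

/-- Reachability by a finite chain of refinements. -/
abbrev RefinesChain (π : P → A) : Form A P → Form A P → Prop :=
  Relation.ReflTransGen (Refines π)

variable {π : P → A} {S S' : Type}

theorem sat_top (M : PEModel A P π S) (a : A) (s : S) : M.sat s (top a) := by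
  simp [top, PEModel.sat, PEModel.defined]

theorem sat_definedness (M : PEModel A P π S) (a₀ : A) (φ : Form A P) (s : S) :
    M.sat s (φ.definedness π a₀) ↔ M.defined s φ := by
  induction φ generalizing s with
  | glob a => simp [definedness, sat_top, PEModel.defined]
  | atom p => rfl
  | neg φ ih => exact ih s
  | conj φ ψ ih₁ ih₂ => simp [definedness, PEModel.sat, PEModel.defined, ih₁, ih₂]
  | know a φ ih => simp [definedness, PEModel.sat, PEModel.defined, ih]

theorem RefinesChain.sat {α β : Form A P} (h : RefinesChain π α β) {M : PEModel A P π S}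
    (hM : M.IsWellFormed) {s : S} (hs : M.sat s β) : M.sat s α := by
  induction h with
  | refl => exact hs
  | tail _ hstep ih => exact ih ((hstep S M hM s).1 hs)

theorem Refines.conj_left {α β : Form A P} (γ : Form A P) (h : Refines π α β) :
    Refines π (.conj α γ) (.conj β γ) := fun S M hM s =>
  ⟨fun hs => ⟨(h S M hM s).1 hs.1, hs.2⟩, fun hs => ⟨(h S M hM s).2 hs.1, M.defined_of_sat hs.2⟩⟩

theorem Refines.conj_right {α β : Form A P} (γ : Form A P) (h : Refines π α β) :
    Refines π (.conj γ α) (.conj γ β) := fun S M hM s =>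
  ⟨fun hs => ⟨hs.1, (h S M hM s).1 hs.2⟩, fun hs => ⟨M.defined_of_sat hs.1, (h S M hM s).2 hs.2⟩⟩

theorem Refines.know {α β : Form A P} (a : A) (h : Refines π α β) :
    Refines π (.know a α) (.know a β) := fun S M hM _ =>
  ⟨fun ⟨t, ht, hs⟩ => ⟨t, ht, (h S M hM t).1 hs⟩, fun ⟨t, ht, hs⟩ => ⟨t, ht, (h S M hM t).2 hs⟩⟩

theorem refines_top_glob (a₀ a : A) : Refines π (top a₀) (.glob a) := fun _ M _ s =>
  ⟨fun _ => sat_top M a₀ s, fun _ => trivial⟩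

theorem refines_top_conj (a₀ : A) : Refines π (top a₀) (.conj (top a₀) (top a₀)) := fun _ M _ s =>
  ⟨fun _ => sat_top M a₀ s,
    fun _ => ⟨M.defined_of_sat (sat_top M a₀ s), M.defined_of_sat (sat_top M a₀ s)⟩⟩

theorem refines_glob_know (a₀ a : A) : Refines π (.glob a) (.know a (top a₀)) := fun _ M hM s =>
  ⟨fun ⟨_, ht, _⟩ => hM.rel_refl_right ht, fun hs => ⟨s, hs, M.defined_of_sat (sat_top M a₀ s)⟩⟩

theorem refinesChain_definedness (π : P → A) (a₀ : A) (φ : Form A P) :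
    RefinesChain π (top a₀) (φ.definedness π a₀) := by
  induction φ with
  | glob a => exact .refl
  | atom p => exact .single (refines_top_glob a₀ (π p))
  | neg φ ih => exact ih
  | conj φ ψ ih₁ ih₂ =>
    exact ((Relation.ReflTransGen.single (refines_top_conj a₀)).trans
      (ih₁.lift (Form.conj · (top a₀)) fun _ _ h => h.conj_left (top a₀))).trans
      (ih₂.lift (Form.conj (φ.definedness π a₀)) fun _ _ h => h.conj_right _)
  | know a φ ih =>
    exact ((Relation.ReflTransGen.single (refines_top_glob a₀ a)).tail
      (refines_glob_know a₀ a)).trans (ih.lift (Form.know a) fun _ _ h => h.know a)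

/-- The first formula in the chain that fails at `s` is defined at `s`, so its negation
holds at `s`. -/
theorem RefinesChain.exists_separating {α β : Form A P} (h : RefinesChain π α β)
    {M : PEModel A P π S} {M' : PEModel A P π S'} (hM : M.IsWellFormed) (hM' : M'.IsWellFormed)
    {s : S} {s' : S'} (hα : M.sat s α) (hβ : ¬ M.sat s β) (hβ' : M'.sat s' β) :
    ∃ ψ : Form A P, M.sat s ψ ∧ ¬ M'.sat s' ψ := by
  induction h using Relation.ReflTransGen.head_induction_on with
  | refl => exact absurd hα hβ
  | @head α γ hstep htail ih =>
    by_cases hγ : M.sat s γ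
    · exact ih hγ
    · exact ⟨.neg γ, ⟨(hstep S M hM s).2 hα, hγ⟩, fun h => h.2 (RefinesChain.sat htail hM' hβ')⟩

/-- Separation from each state of a finite set gives, by conjunction, a single separating formula. -/
theorem exists_separating_of_finite {M : PEModel A P π S} {M' : PEModel A P π S'} (a : A) {t : S}
    {T : Set S'} (hT : T.Finite) (h : ∀ t' ∈ T, ∃ ψ : Form A P, M.sat t ψ ∧ ¬ M'.sat t' ψ) :
    ∃ ψ : Form A P, M.sat t ψ ∧ ∀ t' ∈ T, ¬ M'.sat t' ψ := by
  induction T, hT using Set.Finite.induction_on with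
  | empty => exact ⟨top a, sat_top M a t, by simp⟩
  | @insert t₀ T _ _ ih =>
    obtain ⟨ψ, hψ, hψT⟩ := ih fun t' ht' => h t' (Set.mem_insert_of_mem _ ht')
    obtain ⟨χ, hχ, hχt⟩ := h t₀ (Set.mem_insert _ _)
    refine ⟨.conj ψ χ, ⟨hψ, hχ⟩, ?_⟩
    rintro t' (rfl | ht') hsat
    · exact hχt hsat.2
    · exact hψT t' ht' hsat.1

end Form

section

variable {A P : Type} {π : P → A} {S S' : Type} {M : PEModel A P π S} {M' : PEModel A P π S'}

theorem ModEquivPar.symm {s : S} {s' : S'} (h : ModEquivPar M s M' s') : ModEquivPar M' s' M s :=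
  fun φ => ⟨(h φ).1.symm, (h φ).2.1.symm, (h φ).2.2.symm⟩

theorem modEquivPar_of_iff {s : S} {s' : S'}
    (h : ∀ φ : Form A P, (M.defined s φ ↔ M'.defined s' φ) ∧ (M.sat s φ ↔ M'.sat s' φ)) :
    ModEquivPar M s M' s' :=
  fun φ => ⟨(h φ).1, (h φ).2, and_congr (h φ).1 (not_congr (h φ).2)⟩

/-- One-sided preservation of satisfaction already yields modal equivalence. -/
theorem modEquivPar_of_sat_imp (hM : M.IsWellFormed) (hM' : M'.IsWellFormed) (a : A) {s : S}
    {s' : S'} (h : ∀ φ : Form A P, M.sat s φ → M'.sat s' φ) : ModEquivPar M s M' s' := by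
  have hdef (φ : Form A P) : M.defined s φ ↔ M'.defined s' φ := by
    rw [← Form.sat_definedness M a, ← Form.sat_definedness M' a]
    refine ⟨h _, fun hs' => by_contra fun hs => ?_⟩
    obtain ⟨ψ, hψ, hψ'⟩ := (Form.refinesChain_definedness π a φ).exists_separating hM hM'
      (Form.sat_top M a s) hs hs'
    exact hψ' (h ψ hψ)
  refine modEquivPar_of_iff fun φ => ⟨hdef φ, h φ, fun hs' => by_contra fun hs => ?_⟩
  exact (h (.neg φ) ⟨(hdef φ).2 (M'.defined_of_sat hs'), hs⟩).2 hs'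

theorem ModEquivPar.forth (hM : M.IsWellFormed) (hM' : M'.IsWellFormed) (hIF' : M'.ImageFinite)
    {s t : S} {s' : S'} (h : ModEquivPar M s M' s') {a : A} (ht : M.rel a t s) :
    ∃ t', M'.rel a t' s' ∧ ModEquivPar M t M' t' := by
  by_contra! hne
  have hs' : M'.rel a s' s' := (h (.glob a)).2.1.1 (hM.rel_refl_right ht)
  obtain ⟨ψ, hψ, hψ'⟩ := Form.exists_separating_of_finite (M := M) (M' := M') (t := t) a
    (hIF' a s' hs') fun t' ht' => by
      by_contra! hall
      exact hne t' (hM'.rel_symm ht') (modEquivPar_of_sat_imp hM hM' a hall)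
  obtain ⟨t', ht', hsat⟩ := (h (.know a ψ)).2.1.1 ⟨t, ht, hψ⟩
  exact hψ' t' (hM'.rel_symm ht') hsat

theorem isLifeBisim_modEquivPar (hM : M.IsWellFormed) (hM' : M'.IsWellFormed)
    (hIF : M.ImageFinite) (hIF' : M'.ImageFinite) {s : S} {s' : S'} (h : ModEquivPar M s M' s') :
    IsLifeBisim M M' fun t t' => ModEquivPar M t M' t' := by
  refine ⟨⟨s, s', h⟩, fun t t' ht => ⟨⟨fun a => ?_, ?_⟩, ?_, ?_⟩⟩
  · rw [hM.2.2.2.2, hM'.2.2.2.2]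
    exact (ht (.glob a)).2.1
  · rintro _ ha p rfl
    have ha' : M'.rel (π p) t' t' := (ht (.atom p)).1.1 ha
    exact ⟨fun hp => ((ht (.atom p)).2.1.1 ⟨ha, hp⟩).2, fun hp => ((ht (.atom p)).2.1.2 ⟨ha', hp⟩).2⟩
  · exact fun a _ u hu => ht.forth hM hM' hIF' hu
  · intro a _ u' hu'
    obtain ⟨u, hu, hequiv⟩ := ht.symm.forth hM' hM hIF hu'
    exact ⟨u, hu, hequiv.symm⟩

theorem IsLifeBisim.modEquivPar (hM : M.IsWellFormed) (hM' : M'.IsWellFormed)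
    {Z : S → S' → Prop} (hZ : IsLifeBisim M M' Z) {s : S} {s' : S'} (hs : Z s s') :
    ModEquivPar M s M' s' := by
  have hrel {t : S} {t' : S'} (ht : Z t t') (a : A) : M.rel a t t ↔ M'.rel a t' t' := by
    rw [← hM.2.2.2.2, ← hM'.2.2.2.2]
    exact (hZ.2 t t' ht).1.1 a
  have hknow {t : S} {t' : S'} (ht : Z t t') (a : A) {p : S → Prop} {p' : S' → Prop}
      (hp : ∀ u u', Z u u' → (p u ↔ p' u')) :
      (∃ u, M.rel a u t ∧ p u) ↔ ∃ u', M'.rel a u' t' ∧ p' u' := by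
    constructor
    · rintro ⟨u, hu, hpu⟩
      obtain ⟨u', hu', huZ⟩ := (hZ.2 t t' ht).2.1 a (hM.rel_refl_right hu) u hu
      exact ⟨u', hu', (hp u u' huZ).1 hpu⟩
    · rintro ⟨u', hu', hpu'⟩
      obtain ⟨u, hu, huZ⟩ := (hZ.2 t t' ht).2.2 a (hM'.rel_refl_right hu') u' hu'
      exact ⟨u, hu, (hp u u' huZ).2 hpu'⟩
  refine modEquivPar_of_iff fun φ => ?_
  induction φ generalizing s s' with
  | glob a => exact ⟨Iff.rfl, hrel hs a⟩
  | atom p =>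
    refine ⟨hrel hs _, ?_⟩
    simp only [PEModel.sat, ← hrel hs]
    exact and_congr_right fun ha => (hZ.2 s s' hs).1.2 _ ha p rfl
  | neg φ ih => exact ⟨(ih hs).1, and_congr (ih hs).1 (not_congr (ih hs).2)⟩
  | conj φ ψ ih₁ ih₂ =>
    exact ⟨and_congr (ih₁ hs).1 (ih₂ hs).1, and_congr (ih₁ hs).2 (ih₂ hs).2⟩
  | know a φ ih =>
    exact ⟨hknow hs a fun _ _ hu => (ih hu).1, hknow hs a fun _ _ hu => (ih hu).2⟩

end

/-- **Theorem 5.12 (Hennessy–Milner property for partial epistemic models).**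
For any image-finite pointed partial epistemic models `(M,s)` and `(M',s')`:
`(M,s)` is life bisimilar to `(M',s')` iff `(M,s) ≡^par (M',s')`. -/
theorem hennessy_milner_partial_epistemic
    {A P S S' : Type} [Fintype A] [Countable P] {π : P → A}
    (M : PEModel A P π S) (M' : PEModel A P π S')
    (hM : M.IsWellFormed) (hM' : M'.IsWellFormed)
    (hIF : M.ImageFinite) (hIF' : M'.ImageFinite)
    (s : S) (s' : S') :
    (∃ Z, IsLifeBisim M M' Z ∧ Z s s') ↔ ModEquivPar M s M' s' :=
  ⟨fun ⟨_, hZ, hs⟩ => hZ.modEquivPar hM hM' hs,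
    fun h => ⟨_, isLifeBisim_modEquivPar hM hM' hIF hIF' h, h⟩⟩

end ISC
end
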